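/- arXiv:1908.08349 — 2 statements merged into one kernel-verified Lean document; each statement's English description precedes it below -/
import Mathlib

section
/- Let X be a nonempty set and let Φ be a mapping with domain X² such that |Φ(X²)| ≤ ℵ₀. Then the following three conditions are equivalent: (i) Φ is combinatorially similar to an ultrametric d : X² → ℝ⁺ whose range is contained in the nonnegative rationals ℚ⁺; (ii) Φ is combinatorially similar to an ultrametric; (iii) Φ is symmetric, the transitive closure u_Φᵗ of the binary relation u_Φ is antisymmetric, the equality Φ⁻¹(a₀) = Δ_X holds for some a₀ ∈ Φ(X²), where Δ_X = {⟨x,x⟩ : x ∈ X} is the diagonal of X, and for every triple ⟨x₁,x₂,x₃⟩ of points of X there is a permutation ⟨x_{i₁},x_{i₂},x_{i₃}⟩ of it such that Φ(x_{i₁},x_{i₂}) = Φ(x_{i₂},x_{i₃}). -/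
namespace CombSimPaper

/-- The range `Φ(X²)` of a mapping `Φ` with domain `X²`. -/
def rng {X A : Type*} (Φ : X → X → A) : Set A := {a | ∃ x y, Φ x y = a}

/-- `Φ` is strongly consistent with the binary relation `R` on `X`. -/
def StronglyConsistent {X A : Type*} (Φ : X → X → A) (R : X → X → Prop) : Prop :=
  ∀ x₁ x₂ x₃ x₄, R x₁ x₂ → R x₃ x₄ → Φ x₁ x₃ = Φ x₂ x₄

/-- The fiber `Φ⁻¹(a)`, viewed as a binary relation on `X`. -/
def fiber {X A : Type*} (Φ : X → X → A) (a : A) : X → X → Prop :=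
  fun x y => Φ x y = a

/-- `Φ` is `a₀`-coherent: the fiber `Φ⁻¹(a₀)` is an equivalence relation and `Φ` is
strongly consistent with it. -/
def Coherent {X A : Type*} (Φ : X → X → A) (a₀ : A) : Prop :=
  Equivalence (fiber Φ a₀) ∧ StronglyConsistent Φ (fiber Φ a₀)

/-- `g : Y → X` is a combinatorial similarity for the mappings `Ψ` (with domain `Y²`)
and `Φ` (with domain `X²`). -/
def CombSimWith {X Y A B : Type*} (Φ : X → X → A) (Ψ : Y → Y → B) (g : Y → X) : Prop :=
  Function.Bijective g ∧ ∃ f : A → B, Set.BijOn f (rng Φ) (rng Ψ) ∧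
    ∀ x y : Y, Ψ x y = f (Φ (g x) (g y))

/-- `Φ` is combinatorially similar to `Ψ`. -/
def CombSim {X Y A B : Type*} (Φ : X → X → A) (Ψ : Y → Y → B) : Prop :=
  ∃ g : Y → X, CombSimWith Φ Ψ g

/-- Some permutation `⟨x_{i₁}, x_{i₂}, x_{i₃}⟩` of the triple `⟨x₁, x₂, x₃⟩`
satisfies the ternary predicate `P`. -/
def PermTriple {X : Type*} (P : X → X → X → Prop) (x₁ x₂ x₃ : X) : Prop :=
  ∃ σ : Equiv.Perm (Fin 3),
    P (![x₁, x₂, x₃] (σ 0)) (![x₁, x₂, x₃] (σ 1)) (![x₁, x₂, x₃] (σ 2))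

/-- `d : X² → Q` is a `≼`-pseudoultrametric (for the order `le` with smallest element `q₀`). -/
def QPseudoUltra {X Q : Type*} (le : Q → Q → Prop) (q₀ : Q) (d : X → X → Q) : Prop :=
  (∀ x y, d x y = d y x) ∧ (∀ x, d x x = q₀) ∧
  ∀ x₁ x₂ x₃, PermTriple (fun a b c => le (d a c) (d a b) ∧ d a b = d b c) x₁ x₂ x₃

/-- `d : X² → Q` is a `≼`-ultrametric. -/
def QUltra {X Q : Type*} (le : Q → Q → Prop) (q₀ : Q) (d : X → X → Q) : Prop :=
  QPseudoUltra le q₀ d ∧ ∀ x y, d x y = q₀ ↔ x = y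

/-- The binary relation `u_Φ` on the range of `Φ`. -/
def uRel {X A : Type*} (Φ : X → X → A) : A → A → Prop :=
  fun y₁ y₂ => ∃ x₁ x₂ x₃, y₁ = Φ x₁ x₃ ∧ y₂ = Φ x₁ x₂ ∧ Φ x₁ x₂ = Φ x₂ x₃

/-- The binary relation `≼_Φ := u_Φᵗ ∪ Δ_{Φ(X²)}`. -/
def lePhi {X A : Type*} (Φ : X → X → A) : A → A → Prop :=
  fun a b => Relation.TransGen (uRel Φ) a b ∨ (a = b ∧ a ∈ rng Φ)

/-- `r` is a partial order on the subset `S`. -/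
def IsPartialOrderOn {A : Type*} (S : Set A) (r : A → A → Prop) : Prop :=
  (∀ a ∈ S, r a a) ∧
  (∀ a b c, a ∈ S → b ∈ S → c ∈ S → r a b → r b c → r a c) ∧
  (∀ a b, a ∈ S → b ∈ S → r a b → r b a → a = b)

/-- `r` is a linear (total) order on the subset `S`. -/
def IsLinearOrderOn {A : Type*} (S : Set A) (r : A → A → Prop) : Prop :=
  IsPartialOrderOn S r ∧ ∀ a b, a ∈ S → b ∈ S → (r a b ∨ r b a)

/-- A (real-valued, nonnegative) pseudometric. -/
def IsPseudoMetric {X : Type*} (d : X → X → ℝ) : Prop :=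
  (∀ x y, 0 ≤ d x y) ∧ (∀ x y, d x y = d y x) ∧ (∀ x, d x x = 0) ∧
  ∀ x y z, d x y ≤ d x z + d z y

/-- A (real-valued) metric. -/
def IsMetric {X : Type*} (d : X → X → ℝ) : Prop :=
  IsPseudoMetric d ∧ ∀ x y, d x y = 0 ↔ x = y

/-- A (real-valued, nonnegative) pseudoultrametric. -/
def IsPseudoUltrametric {X : Type*} (d : X → X → ℝ) : Prop :=
  (∀ x y, 0 ≤ d x y) ∧ (∀ x y, d x y = d y x) ∧ (∀ x, d x x = 0) ∧
  ∀ x y z, d x y ≤ max (d x z) (d z y)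

/-- A (real-valued) ultrametric. -/
def IsUltrametric {X : Type*} (d : X → X → ℝ) : Prop :=
  IsPseudoUltrametric d ∧ ∀ x y, d x y = 0 ↔ x = y

/-- `d` is a `le`-pseudoultrametric, where `le` is a partial order on `Q` having a smallest
element. -/
def IsPseudoUltraFor {X Q : Type*} (d : X → X → Q) (le : Q → Q → Prop) : Prop :=
  IsPartialOrder Q le ∧ ∃ q₀, (∀ q, le q₀ q) ∧ QPseudoUltra le q₀ d

/-- `g : X₁ → X₂` is a weak similarity for the `Q₁`-pseudoultrametric `d₁` and the
`Q₂`-pseudoultrametric `d₂`: `g` is a bijection and there is an order isomorphism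
`f` of the subposet `d₂(X₂²)` of `Q₂` onto the subposet `d₁(X₁²)` of `Q₁` with
`d₁(x, y) = f (d₂ (g x) (g y))`. -/
def WeakSim {X₁ X₂ Q₁ Q₂ : Type*} (le₁ : Q₁ → Q₁ → Prop) (le₂ : Q₂ → Q₂ → Prop)
    (d₁ : X₁ → X₁ → Q₁) (d₂ : X₂ → X₂ → Q₂) (g : X₁ → X₂) : Prop :=
  Function.Bijective g ∧ ∃ f : Q₂ → Q₁,
    Set.BijOn f (rng d₂) (rng d₁) ∧
    (∀ a ∈ rng d₂, ∀ b ∈ rng d₂, (le₂ a b ↔ le₁ (f a) (f b))) ∧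
    ∀ x y, d₁ x y = f (d₂ (g x) (g y))

/-- The subset `S`, ordered by `r`, is order-isomorphic to a subposet of `(ℝ⁺, ≤)`. -/
def EmbedsInRPlus {A : Type*} (S : Set A) (r : A → A → Prop) : Prop :=
  ∃ e : A → ℝ, (∀ a ∈ S, 0 ≤ e a) ∧ Set.InjOn e S ∧
    ∀ a ∈ S, ∀ b ∈ S, (r a b ↔ e a ≤ e b)

/-- For a symmetric mapping, a triple has an isosceles permutation iff two of its three
sides coincide. -/
theorem permTriple_isosceles_iff {X A : Type*} {Φ : X → X → A} (hsymm : ∀ x y, Φ x y = Φ y x)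
    (x y z : X) :
    PermTriple (fun a b c => Φ a b = Φ b c) x y z ↔
      Φ x y = Φ y z ∨ Φ y x = Φ x z ∨ Φ x z = Φ z y := by
  constructor
  · rintro ⟨σ, h⟩
    have h01 : σ 0 ≠ σ 1 := σ.injective.ne (by decide)
    have h02 : σ 0 ≠ σ 2 := σ.injective.ne (by decide)
    have h12 : σ 1 ≠ σ 2 := σ.injective.ne (by decide)
    generalize σ 0 = i at *
    generalize σ 1 = j at *
    generalize σ 2 = k at *
    fin_cases i <;> fin_cases j <;> fin_cases k <;> simp at h h01 h02 h12 <;> grind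
  · rintro (h | h | h)
    · exact ⟨1, by simpa using h⟩
    · exact ⟨Equiv.swap 0 1, by simpa [Equiv.swap_apply_of_ne_of_ne] using h⟩
    · exact ⟨Equiv.swap 1 2, by simpa [Equiv.swap_apply_of_ne_of_ne] using h⟩

/-- In an ultrametric space every triangle is isosceles. -/
theorem IsUltrametric.isosceles {X : Type*} {d : X → X → ℝ} (hd : IsUltrametric d) (x y z : X) :
    d x y = d y z ∨ d y x = d x z ∨ d x z = d z y := by
  obtain ⟨⟨-, hsymm, -, htri⟩, -⟩ := hd
  have h₁ := htri x y z
  have h₂ := htri y z x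
  have h₃ := htri x z y
  rw [hsymm z y] at h₁ ⊢
  rw [hsymm y x] at h₂ ⊢
  rw [le_max_iff] at h₁ h₂ h₃
  clear hsymm htri
  generalize d x y = a at *
  generalize d y z = b at *
  generalize d x z = c at *
  grind

theorem mem_rng {X A : Type*} (Φ : X → X → A) (x y : X) : Φ x y ∈ rng Φ := ⟨x, y, rfl⟩

theorem CombSim.isosceles_structure {X Y A : Type*} [Nonempty X] {Φ : X → X → A}
    {d : Y → Y → ℝ} (hd : IsUltrametric d) (h : CombSim Φ d) :
    (∀ x y, Φ x y = Φ y x) ∧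
      (∀ ⦃a b⦄, Relation.TransGen (uRel Φ) a b → Relation.TransGen (uRel Φ) b a → a = b) ∧
      (∃ a₀ ∈ rng Φ, ∀ x y, Φ x y = a₀ ↔ x = y) ∧
      ∀ x₁ x₂ x₃ : X, PermTriple (fun a b c => Φ a b = Φ b c) x₁ x₂ x₃ := by
  obtain ⟨g, hg, f, hf, hfd⟩ := h
  have hiff : ∀ x y z w, Φ (g x) (g y) = Φ (g z) (g w) ↔ d x y = d z w := fun x y z w => by
    rw [hfd, hfd, hf.injOn.eq_iff (mem_rng Φ _ _) (mem_rng Φ _ _)]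
  have hsymm : ∀ x y, Φ x y = Φ y x := by
    rw [hg.surjective.forall₂]
    exact fun x y => (hiff _ _ _ _).2 (hd.1.2.1 x y)
  have hmono : ∀ a b, uRel Φ a b → f a ≤ f b := by
    rintro _ _ ⟨x, y, z, rfl, rfl, h⟩
    obtain ⟨x, rfl⟩ := hg.surjective x
    obtain ⟨y, rfl⟩ := hg.surjective y
    obtain ⟨z, rfl⟩ := hg.surjective z
    rw [← hfd, ← hfd]
    simpa [(hiff _ _ _ _).1 h] using hd.1.2.2.2 x z y
  have hmono_trans : ∀ a b, Relation.TransGen (uRel Φ) a b → a ∈ rng Φ ∧ f a ≤ f b := by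
    intro a b h
    refine ⟨?_, ?_⟩
    · obtain ⟨_, ⟨x, _, z, rfl, -⟩, -⟩ := Relation.TransGen.head'_iff.1 h
      exact mem_rng Φ x z
    · induction h with
      | single h => exact hmono _ _ h
      | tail _ h ih => exact ih.trans (hmono _ _ h)
  refine ⟨hsymm, fun a b hab hba => ?_, ?_, ?_⟩
  · obtain ⟨ha, hle⟩ := hmono_trans a b hab
    obtain ⟨hb, hge⟩ := hmono_trans b a hba
    exact hf.injOn ha hb (hle.antisymm hge)
  · obtain ⟨x₀⟩ := ‹Nonempty X›
    refine ⟨Φ x₀ x₀, mem_rng Φ _ _, ?_⟩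
    obtain ⟨x₀, rfl⟩ := hg.surjective x₀
    rw [hg.surjective.forall₂]
    intro x y
    rw [hiff, hd.1.2.2.1, hd.2, hg.injective.eq_iff]
  · intro x y z
    rw [permTriple_isosceles_iff hsymm]
    obtain ⟨x, rfl⟩ := hg.surjective x
    obtain ⟨y, rfl⟩ := hg.surjective y
    obtain ⟨z, rfl⟩ := hg.surjective z
    simpa only [hiff] using hd.isosceles x y z

/-- If the transitive closure of a relation is antisymmetric, the relation can be represented by
the order of the positive rationals on any countable set. -/
theorem exists_injective_monotone_rat {A : Type*} {r : A → A → Prop} {S : Set A}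
    (hS : S.Countable) (hr : ∀ ⦃a b⦄, Relation.TransGen r a b → Relation.TransGen r b a → a = b) :
    ∃ e : S → ℚ, Function.Injective e ∧ (∀ a, 0 < e a) ∧ ∀ a b : S, r a b → e a ≤ e b := by
  let _ : PartialOrder S :=
    { le := fun a b => Relation.ReflTransGen r a b
      le_refl := fun _ => .refl
      le_trans := fun _ _ _ => .trans
      le_antisymm := fun a b hab hba => Subtype.ext <| by
        rcases Relation.reflTransGen_iff_eq_or_transGen.1 hab with h | hab
        · exact h.symm
        rcases Relation.reflTransGen_iff_eq_or_transGen.1 hba with h | hba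
        · exact h
        exact hr hab hba }
  have : Countable (LinearExtension S) := hS.to_subtype
  obtain ⟨e⟩ := Order.embedding_from_countable_to_dense (LinearExtension S) (Set.Ioi (0 : ℚ))
  exact ⟨fun a => e (toLinearExtension a), fun a b h => e.injective (Subtype.ext h),
    fun a => (e (toLinearExtension a)).2,
    fun a b h => e.monotone (toLinearExtension.monotone (Relation.ReflTransGen.single h))⟩

theorem exists_rat_ultrametric_combSim {X A : Type*} {Φ : X → X → A}
    (hcount : (rng Φ).Countable) (hsymm : ∀ x y, Φ x y = Φ y x)
    (hanti : ∀ ⦃a b⦄, Relation.TransGen (uRel Φ) a b → Relation.TransGen (uRel Φ) b a → a = b)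
    {a₀ : A} (ha₀ : ∀ x y, Φ x y = a₀ ↔ x = y)
    (hiso : ∀ x₁ x₂ x₃ : X, PermTriple (fun a b c => Φ a b = Φ b c) x₁ x₂ x₃) :
    ∃ d : X → X → ℝ, IsUltrametric d ∧ (∀ x y, ∃ q : ℚ, 0 ≤ q ∧ d x y = (q : ℝ)) ∧
      CombSim Φ d := by
  classical
  obtain ⟨e, he, hpos, hmono⟩ := exists_injective_monotone_rat hcount hanti
  let F : A → ℚ := fun a => if h : a ∈ rng Φ ∧ a ≠ a₀ then e ⟨a, h.1⟩ else 0
  have hF₀ : F a₀ = 0 := by simp [F]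
  have hF : ∀ a (h : a ∈ rng Φ), a ≠ a₀ → F a = e ⟨a, h⟩ := fun a h h' => dif_pos ⟨h, h'⟩
  have hF_nonneg : ∀ a, 0 ≤ F a := fun a => by
    by_cases h : a ∈ rng Φ ∧ a ≠ a₀
    · exact (hF a h.1 h.2).symm ▸ (hpos _).le
    · exact (dif_neg h : F a = 0).ge
  have hF_inj : Set.InjOn F (rng Φ) := by
    intro a ha b hb hab
    by_cases h : a = a₀ <;> by_cases h' : b = a₀
    · rw [h, h']
    · rw [h, hF₀, hF b hb h'] at hab
      exact absurd hab (hpos _).ne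
    · rw [h', hF₀, hF a ha h] at hab
      exact absurd hab (hpos _).ne'
    · rw [hF a ha h, hF b hb h'] at hab
      exact congrArg Subtype.val (he hab)
  have hF_le : ∀ x y z, Φ x z = Φ z y → F (Φ x y) ≤ F (Φ x z) := by
    intro x y z h
    by_cases hxy : Φ x y = a₀
    · rw [hxy, hF₀]
      exact hF_nonneg _
    · have hxz : Φ x z ≠ a₀ := fun hxz => hxy <| by
        rw [(ha₀ x z).1 hxz, ← h, hxz]
      rw [hF _ (mem_rng Φ _ _) hxy, hF _ (mem_rng Φ _ _) hxz]
      exact hmono _ _ ⟨x, z, y, rfl, rfl, h⟩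
  have hF_zero : ∀ x y, F (Φ x y) = 0 ↔ x = y := fun x y => by
    rw [← ha₀ x y]
    refine ⟨fun h => ?_, fun h => h ▸ hF₀⟩
    by_contra hne
    exact (hpos _).ne' ((hF _ (mem_rng Φ x y) hne).symm.trans h)
  refine ⟨fun x y => (F (Φ x y) : ℝ), ⟨⟨fun x y => ?_, fun x y => ?_, fun x => ?_, ?_⟩, ?_⟩,
    fun x y => ⟨_, hF_nonneg _, rfl⟩, id, Function.bijective_id, fun a => (F a : ℝ),
    ⟨?_, ?_, ?_⟩, fun _ _ => rfl⟩
  · exact Rat.cast_nonneg.2 (hF_nonneg _)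
  · simp only [hsymm x y]
  · exact Rat.cast_eq_zero.2 ((hF_zero x x).2 rfl)
  · intro x y z
    rcases (permTriple_isosceles_iff hsymm x y z).1 (hiso x y z) with h | h | h
    · simp only [h, hsymm y z, le_max_right]
    · simp only [hsymm x y, h, le_max_left]
    · exact le_max_of_le_left (Rat.cast_le.2 (hF_le x y z h))
  · exact fun x y => Rat.cast_eq_zero.trans (hF_zero x y)
  · rintro _ ⟨x, y, rfl⟩
    exact ⟨x, y, rfl⟩
  · exact fun a ha b hb h => hF_inj ha hb (Rat.cast_injective h)
  · rintro _ ⟨x, y, rfl⟩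
    exact ⟨Φ x y, mem_rng Φ x y, rfl⟩

universe u v

/-- Corollary 3.8: for a mapping `Φ` with domain `X²` and at most countable range, the
following are equivalent: (i) `Φ` is combinatorially similar to an ultrametric on `X` with
range in `ℚ⁺`; (ii) `Φ` is combinatorially similar to an ultrametric; (iii) `Φ` is
symmetric, `u_Φᵗ` is antisymmetric, `Φ⁻¹(a₀) = Δ_X` for some `a₀` in the range of `Φ`, and
every triple of points admits an "isosceles" permutation. -/
theorem statement5 {X : Type u} {A : Type v} [Nonempty X]
    (Φ : X → X → A) (hcount : (rng Φ).Countable) :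
    List.TFAE [
      ∃ d : X → X → ℝ, IsUltrametric d ∧ (∀ x y, ∃ q : ℚ, 0 ≤ q ∧ d x y = (q : ℝ)) ∧
        CombSim Φ d,
      ∃ (Y : Type u) (_ : Nonempty Y) (d : Y → Y → ℝ), IsUltrametric d ∧ CombSim Φ d,
      (∀ x y, Φ x y = Φ y x) ∧
        AntiSymmetric (Relation.TransGen (uRel Φ)) ∧
        (∃ a₀ ∈ rng Φ, ∀ x y, Φ x y = a₀ ↔ x = y) ∧
        ∀ x₁ x₂ x₃ : X, PermTriple (fun a b c => Φ a b = Φ b c) x₁ x₂ x₃ ] := by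
  tfae_have 1 → 2 := fun ⟨d, hd, _, h⟩ => ⟨X, inferInstance, d, hd, h⟩
  tfae_have 2 → 3 := fun ⟨_, _, _, hd, h⟩ => h.isosceles_structure hd
  tfae_have 3 → 1 := fun ⟨hsymm, hanti, ⟨_, _, ha₀⟩, hiso⟩ =>
    exists_rat_ultrametric_combSim hcount hsymm hanti ha₀ hiso
  tfae_finish

end CombSimPaper
end

section
/- Let (Q,≼_Q) be a totally ordered set with a smallest element q₀. Then there is a ≼_Q-ultrametric d : Q² → Q such that d(Q²) = Q and ≼_Q⁰ = ≼_Q, where ≼_Q⁰ is the weakest partial order on Q for which d is a pseudoultrametric. (Explicitly, the mapping d(p,q) defined to be q₀ if p = q, to be p if q ≺_Q p, and to be q if p ≺_Q q, has these properties.) -/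
namespace CombSimPaper

theorem permTriple_iff {X : Type*} (P : X → X → X → Prop) (x y z : X) :
    PermTriple P x y z ↔
      P x y z ∨ P x z y ∨ P y x z ∨ P y z x ∨ P z x y ∨ P z y x := by
  constructor
  · rintro ⟨σ, h⟩
    have h01 : σ 0 ≠ σ 1 := σ.injective.ne (by decide)
    have h02 : σ 0 ≠ σ 2 := σ.injective.ne (by decide)
    have h12 : σ 1 ≠ σ 2 := σ.injective.ne (by decide)
    generalize σ 0 = i at *
    generalize σ 1 = j at *
    generalize σ 2 = k at *
    fin_cases i <;> fin_cases j <;> fin_cases k <;> simp_all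
  · rintro (h | h | h | h | h | h)
    · exact ⟨1, h⟩
    · exact ⟨Equiv.swap 1 2, h⟩
    · exact ⟨Equiv.swap 0 1, h⟩
    · exact ⟨finRotate 3, h⟩
    · exact ⟨(finRotate 3).symm, h⟩
    · exact ⟨Equiv.swap 0 2, h⟩

open Classical in
/-- The larger of two distinct points, and `q₀` on the diagonal. -/
noncomputable def maxDist {Q : Type*} (le : Q → Q → Prop) (q₀ p q : Q) : Q :=
  if p = q then q₀ else if le q p then p else q

section MaxDist

variable {Q : Type*} {le : Q → Q → Prop} {q₀ : Q}

theorem maxDist_self (p : Q) : maxDist le q₀ p p = q₀ := by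
  simp [maxDist]

theorem maxDist_of_le [IsPartialOrder Q le] {p q : Q} (hne : p ≠ q) (h : le p q) :
    maxDist le q₀ p q = q := by
  have h' : ¬ le q p := fun h' => hne (antisymm_of le h h')
  simp [maxDist, hne, h']

theorem maxDist_of_ge {p q : Q} (hne : p ≠ q) (h : le q p) :
    maxDist le q₀ p q = p := by
  simp [maxDist, hne, h]

theorem maxDist_bot_left [IsPartialOrder Q le] (hq₀ : ∀ q, le q₀ q) (q : Q) :
    maxDist le q₀ q₀ q = q := by
  by_cases h : q₀ = q
  · rw [← h, maxDist_self]
  · exact maxDist_of_le h (hq₀ q)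

theorem qUltra_maxDist [IsLinearOrder Q le] (hq₀ : ∀ q, le q₀ q) :
    QUltra le q₀ (maxDist le q₀) := by
  have total : ∀ a b, le a b ∨ le b a := total_of le
  have anti : ∀ a b, le a b → le b a → a = b := fun _ _ => antisymm_of le
  refine ⟨⟨fun x y => ?_, maxDist_self, fun x y z => ?_⟩, fun x y => ?_⟩
  · grind [maxDist]
  · have trans : ∀ {a b c}, le a b → le b c → le a c := trans_of le
    have := total x y
    have := total y z
    have := total x z
    have := @trans x y z
    have := @trans x z y
    have := @trans y x z
    have := @trans y z x
    have := @trans z x y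
    have := @trans z y x
    have := anti x y
    have := anti y z
    have := anti x z
    have := hq₀ x
    have := hq₀ y
    have := hq₀ z
    have := refl_of le x
    have := refl_of le y
    have := refl_of le z
    have := refl_of le q₀
    clear total anti trans hq₀
    rw [permTriple_iff]
    simp only [maxDist]
    grind
  · grind [maxDist]

theorem rng_maxDist [IsPartialOrder Q le] (hq₀ : ∀ q, le q₀ q) :
    rng (maxDist le q₀) = Set.univ :=
  Set.eq_univ_of_forall fun q => ⟨q₀, q, maxDist_bot_left hq₀ q⟩

theorem le_of_isPseudoUltraFor_maxDist [IsPartialOrder Q le] (hq₀ : ∀ q, le q₀ q)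
    {le' : Q → Q → Prop} (h : IsPseudoUltraFor (maxDist le q₀) le') {a b : Q} (hab : le a b) :
    le' a b := by
  obtain ⟨_, q₁, hmin, hsymm, hself, htri⟩ := h
  obtain rfl : q₀ = q₁ := (maxDist_self q₀).symm.trans (hself q₀)
  by_cases hne : a = b
  · exact hne ▸ refl_of le' a
  have ha := maxDist_bot_left hq₀ a
  have hb := maxDist_bot_left hq₀ b
  have hd : maxDist le q₀ a b = b := maxDist_of_le hne hab
  have := htri q₀ a b
  rw [permTriple_iff] at this
  grind

end MaxDist

/-- Proposition 4.4: for every totally ordered set `(Q, ≼_Q)` with smallest element `q₀`,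
the explicit mapping `d(p,q) = q₀` if `p = q`, `= p` if `q ≺_Q p`, `= q` if `p ≺_Q q`,
is a `≼_Q`-ultrametric with `d(Q²) = Q` whose weakest admissible order `≼_Q⁰` is `≼_Q`. -/
theorem statement15 {Q : Type*} (leQ : Q → Q → Prop) (q₀ : Q)
    (hlin : IsLinearOrder Q leQ) (hq₀ : ∀ q, leQ q₀ q) :
    ∃ d : Q → Q → Q,
      (∀ p q : Q, (p = q → d p q = q₀) ∧ (p ≠ q → leQ q p → d p q = p) ∧
        (p ≠ q → leQ p q → d p q = q)) ∧
      QUltra leQ q₀ d ∧ rng d = Set.univ ∧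
      ∀ le' : Q → Q → Prop, IsPseudoUltraFor d le' → ∀ a b, leQ a b → le' a b := by
  refine ⟨maxDist leQ q₀, fun p q => ⟨?_, maxDist_of_ge, maxDist_of_le⟩, qUltra_maxDist hq₀,
    rng_maxDist hq₀, fun _ h _ _ => le_of_isPseudoUltraFor_maxDist hq₀ h⟩
  rintro rfl
  exact maxDist_self p

end CombSimPaper
end
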